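/- Every 2-edge-connected finite graph G (loops and multiple edges allowed) has an integer 4-flow φ with |supp(φ)| ≥ (14/15)|E(G)|. -/

import Mathlib

open Finset

/-- The set of edges with exactly one endpoint in `S` (the edge cut `δ(S)`). -/
def cutset {V E : Type} [Fintype E] [DecidableEq V] (src tgt : E → V) (S : Finset V) :
    Finset E :=
  Finset.univ.filter fun e => (src e ∈ S ∧ tgt e ∉ S) ∨ (tgt e ∈ S ∧ src e ∉ S)

/-- A multigraph (given by endpoint maps `src`, `tgt` on an edge type) is `t`-edge-connected:
every edge cut determined by a nonempty proper vertex set has at least `t` edges.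
(For `t ≥ 1` this is equivalent to being connected with all edge cuts of size at least `t`.) -/
def EdgeConnected {V E : Type} [Fintype V] [Fintype E] [DecidableEq V]
    (src tgt : E → V) (t : ℕ) : Prop :=
  ∀ S : Finset V, S.Nonempty → S ≠ Finset.univ → t ≤ (cutset src tgt S).card

/-- The boundary `∂φ(v) = Σ_{e out of v} φ(e) − Σ_{e into v} φ(e)`. -/
def bdry {V E A : Type} [Fintype E] [DecidableEq V] [AddCommGroup A]
    (src tgt : E → V) (φ : E → A) (v : V) : A :=
  (∑ e : E, if src e = v then φ e else 0) - (∑ e : E, if tgt e = v then φ e else 0)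

/-- The degree of `v` with respect to the edge set `F` (a loop at `v` counts twice). -/
def degr {V E : Type} [DecidableEq V] (src tgt : E → V) (F : Finset E) (v : V) : ℕ :=
  (F.filter fun e => src e = v).card + (F.filter fun e => tgt e = v).card

section Boundary

variable {V E : Type} [Fintype E] [DecidableEq V]

lemma bdry_add {A : Type} [AddCommGroup A] (src tgt : E → V) (φ ψ : E → A) :
    bdry src tgt (φ + ψ) = bdry src tgt φ + bdry src tgt ψ := by
  funext v
  simp only [bdry, Pi.add_apply, ← Finset.sum_sub_distrib, ← Finset.sum_add_distrib]
  refine Finset.sum_congr rfl fun e _ => ?_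
  split_ifs <;> abel

lemma bdry_zsmul {A : Type} [AddCommGroup A] (src tgt : E → V) (n : ℤ) (φ : E → A) :
    bdry src tgt (n • φ) = n • bdry src tgt φ := by
  funext v
  simp [bdry, smul_sub, Finset.smul_sum, smul_ite]

lemma bdry_single [DecidableEq E] {A : Type} [AddCommGroup A] (src tgt : E → V) (e : E) (a : A) :
    bdry src tgt (Pi.single e a) = Pi.single (src e) a - Pi.single (tgt e) a := by
  funext v
  simp only [bdry, Pi.sub_apply, Pi.single_apply, eq_comm (a := v)]
  congr 1 <;>
  · rw [Finset.sum_eq_single e] <;> simp +contextual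

lemma bdry_update_tgt [DecidableEq E] {A : Type} [AddCommGroup A] (src tgt : E → V) (e : E) (w : V)
    (φ : E → A) :
    bdry src (Function.update tgt e w) φ =
      bdry src tgt φ + Pi.single (tgt e) (φ e) - Pi.single w (φ e) := by
  funext v
  have key : ∀ t : E → V, (∑ g, if t g = v then φ g else 0) =
      (if t e = v then φ e else 0) + ∑ g ∈ univ.erase e, if t g = v then φ g else 0 :=
    fun t => (Finset.add_sum_erase _ _ (mem_univ e)).symm
  have rest : (∑ g ∈ univ.erase e, if Function.update tgt e w g = v then φ g else 0) =
      ∑ g ∈ univ.erase e, if tgt g = v then φ g else 0 :=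
    Finset.sum_congr rfl fun g hg => by rw [Function.update_of_ne (Finset.ne_of_mem_erase hg)]
  simp only [bdry, Pi.sub_apply, Pi.add_apply, Pi.single_apply, eq_comm (a := v)]
  rw [key (Function.update tgt e w), key tgt, rest, Function.update_self]
  abel

lemma sum_mul_bdry [Fintype V] {R : Type} [CommRing R] (src tgt : E → V) (p : V → R) (φ : E → R) :
    ∑ v, p v * bdry src tgt φ v = ∑ e, φ e * (p (src e) - p (tgt e)) := by
  simp only [bdry, mul_sub, Finset.sum_sub_distrib, Finset.mul_sum, mul_ite, mul_zero]
  congr 1 <;>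
  · rw [Finset.sum_comm]
    simp [mul_comm]

lemma mem_cutset {src tgt : E → V} {S : Finset V} {e : E} :
    e ∈ cutset src tgt S ↔ (src e ∈ S ∧ tgt e ∉ S) ∨ (tgt e ∈ S ∧ src e ∉ S) := by
  simp [cutset]

lemma sum_bdry_eq_sum_cutset [Fintype V] (src tgt : E → V) (J : E → ZMod 2) (U : Finset V) :
    ∑ v ∈ U, bdry src tgt J v = ∑ e ∈ cutset src tgt U, J e := by
  have h := sum_mul_bdry src tgt (fun v => if v ∈ U then (1 : ZMod 2) else 0) J
  simp only [ite_mul, one_mul, zero_mul, Finset.sum_ite_mem, Finset.univ_inter] at h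
  rw [h, cutset, Finset.sum_filter]
  refine Finset.sum_congr rfl fun e _ => ?_
  by_cases h1 : src e ∈ U <;> by_cases h2 : tgt e ∈ U <;> simp [h1, h2]

/-- Every even subgraph carries an integer flow with values `±1` on its edges. -/
lemma exists_unit_flow_of_even [DecidableEq E] (tgt src : E → V) (C : E → ZMod 2)
    (hC : bdry src tgt C = 0) :
    ∃ f : E → ℤ, bdry src tgt f = 0 ∧ ∀ e, (C e = 0 → f e = 0) ∧ (C e ≠ 0 → |f e| = 1) := by
  induction hn : #{e | C e ≠ 0} using Nat.strong_induction_on generalizing tgt C with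
  | _ n ih =>
  by_cases hC0 : ∀ e, C e = 0
  · exact ⟨0, by funext v; simp [bdry], fun e => ⟨fun _ => rfl, fun h => absurd (hC0 e) h⟩⟩
  push Not at hC0
  obtain ⟨e, he⟩ := hC0
  have one_of_ne : ∀ a : ZMod 2, a ≠ 0 → a = 1 := by decide
  have card_lt : ∀ g, C g ≠ 0 → #{h | (C + Pi.single g 1 : E → ZMod 2) h ≠ 0} < n := by
    intro g hg
    rw [← hn]
    refine Finset.card_lt_card ((Finset.ssubset_iff_of_subset ?_).2 ⟨g, by simp [hg], ?_⟩)
    · intro h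
      simp only [mem_filter, mem_univ, true_and, Pi.add_apply]
      by_cases hhg : h = g
      · subst hhg; exact fun _ => hg
      · simp [hhg]
    · simp [one_of_ne _ hg, CharTwo.add_self_eq_zero]
  by_cases hloop : src e = tgt e
  · obtain ⟨f, hf, hfC⟩ := ih _ (card_lt e he) tgt (C + Pi.single e 1)
      (by rw [bdry_add, hC, bdry_single, hloop]; simp) rfl
    refine ⟨f + Pi.single e 1, by rw [bdry_add, hf, bdry_single, hloop]; simp, fun h => ?_⟩
    by_cases hh : h = e
    · subst hh
      have := (hfC h).1 (by simp [one_of_ne _ he, CharTwo.add_self_eq_zero])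
      simp [this, he]
    · simpa [hh] using hfC h
  · obtain ⟨g, hge, hg, w, hw⟩ : ∃ g, g ≠ e ∧ C g ≠ 0 ∧
        ∃ w, (src g = tgt e ∧ tgt g = w) ∨ (src g = w ∧ tgt g = tgt e) := by
      by_contra! hcon
      have h := congrFun hC (tgt e)
      simp only [bdry, ← Finset.sum_sub_distrib, Pi.zero_apply] at h
      rw [Finset.sum_eq_single e] at h
      · simp [hloop, he] at h
      · intro g _ hge
        by_cases hg : C g = 0
        · simp [hg]
        · have hs : src g ≠ tgt e := fun hs => (hcon g hge hg (tgt g)).1 hs rfl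
          have ht : tgt g ≠ tgt e := (hcon g hge hg (src g)).2 rfl
          simp [hs, ht]
      · simp
    obtain ⟨f, hf, hfC⟩ := ih _ (card_lt g hg) (Function.update tgt e w) (C + Pi.single g 1)
      (by
        rw [bdry_update_tgt, bdry_add, hC, bdry_single, Pi.add_apply, one_of_ne _ he,
          Pi.single_eq_of_ne hge.symm]
        funext v
        rcases hw with ⟨h1, h2⟩ | ⟨h1, h2⟩ <;>
          simp only [h1, h2, Pi.add_apply, Pi.sub_apply, Pi.zero_apply, add_zero, zero_add] <;>
          generalize (Pi.single w 1 : V → ZMod 2) v = a <;>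
          generalize (Pi.single (tgt e) 1 : V → ZMod 2) v = b <;>
          revert a b <;> decide) rfl
    rw [bdry_update_tgt] at hf
    have hfe : |f e| = 1 := (hfC e).2 (by simpa [hge.symm] using he)
    have hfg : f g = 0 := (hfC g).1 (by simp [one_of_ne _ hg, CharTwo.add_self_eq_zero])
    have extend : ∀ a : ℤ, |a| = 1 → ∀ h, (C h = 0 → (f + Pi.single g a : E → ℤ) h = 0) ∧
        (C h ≠ 0 → |(f + Pi.single g a : E → ℤ) h| = 1) := by
      intro a ha h
      by_cases hh : h = g
      · subst hh
        simp [hfg, hg, ha]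
      · simpa [hh] using hfC h
    rcases hw with ⟨h1, h2⟩ | ⟨h1, h2⟩
    · refine ⟨f + Pi.single g (f e), ?_, extend _ hfe⟩
      rw [bdry_add, bdry_single, h1, h2, ← hf]
      abel
    · refine ⟨f + Pi.single g (-f e), ?_, extend _ (by rwa [abs_neg])⟩
      rw [bdry_add, bdry_single, h1, h2, ← hf, Pi.single_neg, Pi.single_neg]
      abel

end Boundary

section Joins

variable {V E : Type} [Fintype E] [DecidableEq V]

/-- The total weight of the edge set with `ZMod 2`-indicator `J`. -/
noncomputable def joinCost (c : E → ℝ) (J : E → ZMod 2) : ℝ :=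
  ∑ e, if J e = 0 then 0 else c e

lemma joinCost_add_of_null {c : E → ℝ} {L : E → ZMod 2} (hL : ∀ e, L e ≠ 0 → c e = 0)
    (K : E → ZMod 2) : joinCost c (K + L) = joinCost c K := by
  refine Finset.sum_congr rfl fun e _ => ?_
  by_cases h : L e = 0
  · simp [h]
  · simp [hL e h]

lemma joinCost_add_single [DecidableEq E] (c : E → ℝ) {K : E → ZMod 2} {e : E} (he : K e ≠ 0) :
    joinCost c (K + Pi.single e 1) = joinCost c K - c e := by
  have h1 : K e + 1 = 0 := by generalize K e = a at he; revert a; decide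
  have rest : ∑ x ∈ univ.erase e, (if (K + Pi.single e 1 : E → ZMod 2) x = 0 then 0 else c x) =
      ∑ x ∈ univ.erase e, if K x = 0 then 0 else c x :=
    Finset.sum_congr rfl fun g hg => by simp [Finset.ne_of_mem_erase hg]
  simp only [joinCost]
  rw [← Finset.add_sum_erase univ _ (mem_univ e), rest,
    ← Finset.add_sum_erase univ (fun x => if K x = 0 then 0 else c x) (mem_univ e)]
  simp [he, h1]

/-- Switching two joins along a set contained, up to edges of weight zero, in their symmetric
difference preserves the sum of the weights. -/
lemma joinCost_switch (c : E → ℝ) {J K C : E → ZMod 2}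
    (hC : ∀ e, C e ≠ 0 → c e = 0 ∨ J e + K e ≠ 0) :
    joinCost c (J + C) + joinCost c (K + C) = joinCost c J + joinCost c K := by
  simp only [joinCost, ← Finset.sum_add_distrib, Pi.add_apply]
  refine Finset.sum_congr rfl fun e _ => ?_
  by_cases h0 : C e = 0
  · simp [h0]
  · rcases hC e h0 with h | h
    · simp [h]
    · have cases_mod_two : ∀ a b d : ZMod 2, d ≠ 0 → a + b ≠ 0 →
          d = 1 ∧ (a = 0 ∧ b = 1 ∨ a = 1 ∧ b = 0) := by decide
      obtain ⟨h1, ⟨h2, h3⟩ | ⟨h2, h3⟩⟩ := cases_mod_two _ _ _ h0 h <;>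
        simp [h1, h2, h3, CharTwo.add_self_eq_zero]

/-- `v` and `u` are joined by edges from `F`: either `v = u`, or `F` contains a `{v, u}`-join. -/
def Linked (src tgt : E → V) (F : Set E) (v u : V) : Prop :=
  ∃ L : E → ZMod 2, (∀ e, L e ≠ 0 → e ∈ F) ∧ bdry src tgt L = Pi.single v 1 + Pi.single u 1

variable {src tgt : E → V} {F : Set E}

lemma Linked.refl (v : V) : Linked src tgt F v v :=
  ⟨0, by simp, by funext u; simp [bdry, CharTwo.add_self_eq_zero]⟩

lemma Linked.mono {F' : Set E} (hF : F ⊆ F') {v u : V} (h : Linked src tgt F v u) :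
    Linked src tgt F' v u := by
  obtain ⟨L, hL, hb⟩ := h
  exact ⟨L, fun e he => hF (hL e he), hb⟩

lemma pi_add_self {α : Type} (f : α → ZMod 2) : f + f = 0 := by
  funext a; simp [CharTwo.add_self_eq_zero]

lemma pi_sub_eq_add {α : Type} (f g : α → ZMod 2) : f - g = f + g := by
  funext a; simp [CharTwo.sub_eq_add]

lemma linked_src_iff_linked_tgt {v : V} {e : E} (he : e ∈ F) :
    Linked src tgt F v (src e) ↔ Linked src tgt F v (tgt e) := by
  classical
  have supp : ∀ L : E → ZMod 2, (∀ g, L g ≠ 0 → g ∈ F) →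
      ∀ g, (L + Pi.single e 1 : E → ZMod 2) g ≠ 0 → g ∈ F := by
    intro L hL g hg
    by_cases hge : g = e
    · exact hge ▸ he
    · exact hL g (by simpa [hge] using hg)
  constructor <;> rintro ⟨L, hL, hb⟩ <;> refine ⟨L + Pi.single e 1, supp L hL, ?_⟩ <;>
    rw [bdry_add, hb, bdry_single, pi_sub_eq_add]
  · linear_combination pi_add_self (Pi.single (src e) 1 : V → ZMod 2)
  · linear_combination pi_add_self (Pi.single (tgt e) 1 : V → ZMod 2)

/-- If every `T`-join has positive weight, then some `T`-odd cut consisting of edges of positive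
weight meets every minimum weight `T`-join in at most one edge. -/
lemma exists_cut_meeting_min_joins_once [Fintype V] [DecidableEq E] {c : E → ℝ}
    (hc : ∀ e, 0 ≤ c e) {T : V → ZMod 2} (hT : ∃ J, bdry src tgt J = T)
    (hpos : ∀ J, bdry src tgt J = T → 0 < joinCost c J) :
    ∃ U : Finset V, ∑ v ∈ U, T v = 1 ∧ (∀ e ∈ cutset src tgt U, 0 < c e) ∧
      ∀ J, bdry src tgt J = T → (∀ J', bdry src tgt J' = T → joinCost c J ≤ joinCost c J') →
        #{e ∈ cutset src tgt U | J e ≠ 0} ≤ 1 := by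
  classical
  have exists_edge : ∀ J, bdry src tgt J = T → ∃ e, J e ≠ 0 ∧ 0 < c e := by
    intro J hJ
    by_contra! hcon
    refine (hpos J hJ).not_ge (Finset.sum_nonpos fun e _ => ?_)
    split_ifs with h
    · exact le_rfl
    · exact hcon e h
  obtain ⟨K, ⟨s, v, hK⟩, hmin⟩ := Set.exists_min_image
    {K : E → ZMod 2 | ∃ s v, bdry src tgt K = T + Pi.single s 1 + Pi.single v 1}
    (joinCost c) (Set.toFinite _) (by
      obtain ⟨J, hJ⟩ := hT
      obtain ⟨e, -⟩ := exists_edge J hJ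
      exact ⟨J, src e, src e, by rw [hJ, add_assoc, pi_add_self, add_zero]⟩)
  have hmin : ∀ K' s' v', bdry src tgt K' = T + Pi.single s' 1 + Pi.single v' 1 →
      joinCost c K ≤ joinCost c K' := fun K' s' v' h => hmin K' ⟨s', v', h⟩
  set Z : Set E := {e | c e = 0}
  set U : Finset V := {u | Linked src tgt Z v u} with hU
  have memU : ∀ u, u ∈ U ↔ Linked src tgt Z v u := by simp [hU]
  have hvU : v ∈ U := (memU v).2 (Linked.refl v)
  have cut_pos : ∀ e ∈ cutset src tgt U, 0 < c e := by
    intro e he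
    refine (hc e).lt_of_ne' fun h0 => ?_
    have := linked_src_iff_linked_tgt (src := src) (tgt := tgt) (v := v) (F := Z) (e := e) h0
    rw [mem_cutset, memU, memU] at he
    tauto
  have avoid : ∀ K', bdry src tgt K' = T + Pi.single s 1 + Pi.single v 1 →
      joinCost c K' ≤ joinCost c K → ∀ e ∈ cutset src tgt U, K' e = 0 := by
    intro K' hK' hle e he
    by_contra hne
    obtain ⟨u, b, hu, hub⟩ : ∃ u b, u ∈ U ∧
        (Pi.single (src e) 1 + Pi.single (tgt e) 1 : V → ZMod 2) =
          Pi.single u 1 + Pi.single b 1 := by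
      rcases mem_cutset.1 he with h | h
      · exact ⟨_, _, h.1, rfl⟩
      · exact ⟨_, _, h.1, add_comm _ _⟩
    obtain ⟨L, hLZ, hL⟩ := (memU u).1 hu
    have hLe : L e = 0 := by
      by_contra h
      exact (cut_pos e he).ne' (hLZ e h)
    have h1 := hmin (K' + L + Pi.single e 1) s b (by
      rw [bdry_add, bdry_add, hK', hL, bdry_single, pi_sub_eq_add, hub]
      linear_combination pi_add_self (Pi.single v 1 : V → ZMod 2) +
        pi_add_self (Pi.single u 1 : V → ZMod 2))
    rw [joinCost_add_single c (by simpa [hLe] using hne), joinCost_add_of_null hLZ] at h1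
    linarith [cut_pos e he]
  have hsU : s ∉ U := by
    intro hs
    obtain ⟨L, hLZ, hL⟩ := (memU s).1 hs
    have hKL : bdry src tgt (K + L) = T := by
      rw [bdry_add, hK, hL]
      linear_combination pi_add_self (Pi.single v 1 : V → ZMod 2) +
        pi_add_self (Pi.single s 1 : V → ZMod 2)
    obtain ⟨e, he, hce⟩ := exists_edge _ hKL
    have h1 := hmin (K + L + Pi.single e 1) (src e) (tgt e) (by
      rw [bdry_add, hKL, bdry_single, pi_sub_eq_add, add_assoc])
    rw [joinCost_add_single c he, joinCost_add_of_null hLZ] at h1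
    linarith
  have K_cut := avoid K hK le_rfl
  refine ⟨U, ?_, cut_pos, fun J hJ hJmin => ?_⟩
  · have h := sum_bdry_eq_sum_cutset src tgt K U
    rw [Finset.sum_eq_zero K_cut, hK] at h
    simp only [Pi.add_apply, Finset.sum_add_distrib, Finset.sum_pi_single', hsU, hvU, if_true,
      if_false, add_zero] at h
    generalize ∑ v ∈ U, T v = a at h
    revert a; decide
  have no_cycle : ∀ g ∈ cutset src tgt U, ∀ C : E → ZMod 2, bdry src tgt C = 0 →
      (∀ h, C h ≠ 0 → c h = 0 ∨ J h + K h ≠ 0) → C g = 0 := by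
    intro g hg C hC hCH
    have h1 := joinCost_switch c hCH
    have h2 := hJmin (J + C) (by rw [bdry_add, hJ, hC, add_zero])
    have h3 := avoid (K + C) (by rw [bdry_add, hK, hC, add_zero]) (by linarith) g hg
    simpa [K_cut g hg] using h3
  have hJK : bdry src tgt (J + K) = Pi.single s 1 + Pi.single v 1 := by
    rw [bdry_add, hJ, hK]
    linear_combination pi_add_self T
  refine Finset.card_le_one.2 fun e he f hf => ?_
  simp only [mem_filter] at he hf
  by_contra hef
  set H : E → Set E := fun g => {h | h ≠ g ∧ (c h = 0 ∨ J h + K h ≠ 0)}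
  have not_linked : ∀ g ∈ cutset src tgt U, J g ≠ 0 → ¬ Linked src tgt (H g) v s := by
    rintro g hg hJg ⟨L, hLH, hL⟩
    have hLg : L g = 0 := by
      by_contra h
      exact (hLH g h).1 rfl
    refine hJg ?_
    have := no_cycle g hg (J + K + L)
      (by
        rw [bdry_add, hJK, hL]
        linear_combination pi_add_self (Pi.single v 1 : V → ZMod 2) +
          pi_add_self (Pi.single s 1 : V → ZMod 2))
      (fun h hh => by
        by_cases hJKh : J h + K h = 0
        · exact (hLH h (by simpa [hJKh] using hh)).2
        · exact Or.inr hJKh)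
    simpa [hLg, K_cut g hg] using this
  have linked_ends : ∀ g ∈ cutset src tgt U, ∀ h ∈ cutset src tgt U, J h ≠ 0 → g ≠ h →
      Linked src tgt (H g) v (src h) ∧ Linked src tgt (H g) v (tgt h) := by
    intro g hg h hh hJh hgh
    have hZH : Z ⊆ H g := fun z hz => ⟨fun hzg => (cut_pos g hg).ne' (hzg ▸ hz), Or.inl hz⟩
    have hmem : h ∈ H g := ⟨hgh.symm, Or.inr (by simpa [K_cut h hh] using hJh)⟩
    have := linked_src_iff_linked_tgt (src := src) (tgt := tgt) (v := v) hmem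
    rcases mem_cutset.1 hh with h' | h'
    · have h1 := ((memU _).1 h'.1).mono hZH
      exact ⟨h1, this.1 h1⟩
    · have h1 := ((memU _).1 h'.1).mono hZH
      exact ⟨this.2 h1, h1⟩
  set q : V → ZMod 2 := fun u =>
    if Linked src tgt (H e) v u ∨ Linked src tgt (H f) v u then 0 else 1 with hq
  have hqs : q s = 1 := if_neg (not_or.2 ⟨not_linked e he.1 he.2, not_linked f hf.1 hf.2⟩)
  have hqv : q v = 0 := if_pos (Or.inl (Linked.refl v))
  have key := sum_mul_bdry src tgt q (J + K)
  rw [hJK, Finset.sum_eq_zero (s := univ)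
    (f := fun g => (J + K) g * (q (src g) - q (tgt g)))] at key
  · simp [mul_add, Finset.sum_add_distrib, Pi.single_apply, hqs, hqv] at key
  · intro g _
    by_cases hg : J g + K g = 0
    · simp [hg]
    suffices q (src g) = q (tgt g) by simp [this]
    by_cases hge : g = e
    · subst hge
      have := linked_ends f hf.1 g he.1 he.2 (Ne.symm hef)
      simp [hq, this.1, this.2]
    by_cases hgf : g = f
    · subst hgf
      have := linked_ends e he.1 g hf.1 hf.2 hef
      simp [hq, this.1, this.2]
    have he' : g ∈ H e := ⟨hge, Or.inr hg⟩
    have hf' : g ∈ H f := ⟨hgf, Or.inr hg⟩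
    have iff_e := linked_src_iff_linked_tgt (src := src) (tgt := tgt) (v := v) he'
    have iff_f := linked_src_iff_linked_tgt (src := src) (tgt := tgt) (v := v) hf'
    simp only [hq, iff_e, iff_f]

lemma joinCost_eq_sum_filter (c : E → ℝ) (J : E → ZMod 2) :
    joinCost c J = ∑ e with J e ≠ 0, c e := by
  simp [joinCost, Finset.sum_filter]

/-- The `T`-join polyhedron theorem: if `x ≥ 0` has total at least `1` on every `T`-odd cut, then
for any weights `c ≥ 0` some `T`-join has weight at most `∑ e, c e * x e`. -/
lemma exists_join_joinCost_le [Fintype V] [DecidableEq E] {x c : E → ℝ} (hx : ∀ e, 0 ≤ x e)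
    (hc : ∀ e, 0 ≤ c e) {T : V → ZMod 2} (hT : ∃ J, bdry src tgt J = T)
    (hcut : ∀ U : Finset V, ∑ v ∈ U, T v = 1 → 1 ≤ ∑ e ∈ cutset src tgt U, x e) :
    ∃ J, bdry src tgt J = T ∧ joinCost c J ≤ ∑ e, c e * x e := by
  by_contra! hcon
  obtain ⟨δ, hδ, hcδ⟩ : ∃ δ > 0, ∀ J, bdry src tgt J = T →
      δ ≤ joinCost c J - ∑ e, c e * x e := by
    obtain ⟨J₀, hJ₀, hmin⟩ := Set.exists_min_image {J : E → ZMod 2 | bdry src tgt J = T}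
      (joinCost c) (Set.toFinite _) hT
    exact ⟨joinCost c J₀ - ∑ e, c e * x e, sub_pos.2 (hcon J₀ hJ₀),
      fun J hJ => sub_le_sub_right (hmin J hJ) _⟩
  have hclosed : IsClosed {d : E → ℝ | ∀ J, bdry src tgt J = T →
      δ ≤ joinCost d J - ∑ e, d e * x e} := by
    simp only [Set.ofPred_forall]
    refine isClosed_iInter fun J => isClosed_iInter fun _ => isClosed_le continuous_const ?_
    simp only [joinCost_eq_sum_filter]
    fun_prop
  obtain ⟨d, ⟨⟨hd0, hdc⟩, hdδ⟩, hdmin⟩ :=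
    ((isCompact_Icc (a := (0 : E → ℝ)) (b := c)).inter_right hclosed).exists_isMinOn
      ⟨c, ⟨hc, le_rfl⟩, hcδ⟩
      (f := fun d => ∑ e, d e) (by fun_prop)
  have hdx : 0 ≤ ∑ e, d e * x e := Finset.sum_nonneg fun e _ => mul_nonneg (hd0 e) (hx e)
  obtain ⟨U, hUT, hUpos, hUonce⟩ := exists_cut_meeting_min_joins_once hd0 hT
    fun J hJ => by linarith [hdδ J hJ]
  have hxU := hcut U hUT
  obtain ⟨ε, ⟨hεd, hεJ⟩, hε⟩ : ∃ ε : ℝ, ((∀ e, e ∈ cutset src tgt U → ε ≤ d e) ∧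
      ∀ J, bdry src tgt J = T → δ ≤ (joinCost d J - ε * #{e ∈ cutset src tgt U | J e ≠ 0}) -
        (∑ e, d e * x e - ε * ∑ e ∈ cutset src tgt U, x e)) ∧ 0 < ε := by
    suffices h : ∀ᶠ ε : ℝ in nhdsWithin 0 (Set.Ioi 0), (∀ e, e ∈ cutset src tgt U → ε ≤ d e) ∧
        ∀ J, bdry src tgt J = T → δ ≤ (joinCost d J - ε * #{e ∈ cutset src tgt U | J e ≠ 0}) -
          (∑ e, d e * x e - ε * ∑ e ∈ cutset src tgt U, x e) from
      (h.and self_mem_nhdsWithin).exists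
    refine Filter.Eventually.and ?_ ?_
    · refine Filter.eventually_all.2 fun e => ?_
      by_cases he : e ∈ cutset src tgt U
      · filter_upwards [nhdsWithin_le_nhds (eventually_le_nhds (hUpos e he))] with ε hε _ using hε
      · simp [he]
    · refine Filter.eventually_all.2 fun J => ?_
      by_cases hJ : bdry src tgt J = T
      swap
      · simp [hJ]
      by_cases hJmin : ∀ J', bdry src tgt J' = T → joinCost d J ≤ joinCost d J'
      · filter_upwards [self_mem_nhdsWithin] with ε (hε : 0 < ε) _
        have h1 : (#{e ∈ cutset src tgt U | J e ≠ 0} : ℝ) ≤ 1 := by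
          exact_mod_cast hUonce J hJ hJmin
        nlinarith [hdδ J hJ]
      · push Not at hJmin
        obtain ⟨J', hJ', hlt⟩ := hJmin
        have hlim : Filter.Tendsto (fun ε : ℝ => ε * #{e ∈ cutset src tgt U | J e ≠ 0})
            (nhds 0) (nhds 0) := by
          have : Continuous fun ε : ℝ => ε * (#{e ∈ cutset src tgt U | J e ≠ 0} : ℝ) := by
            fun_prop
          simpa using this.tendsto 0
        filter_upwards [nhdsWithin_le_nhds (hlim.eventually_le_const (sub_pos.2 hlt)),
          self_mem_nhdsWithin] with ε h1 (hε : 0 < ε) _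
        nlinarith [hdδ J' hJ']
  set d' : E → ℝ := fun e => d e - if e ∈ cutset src tgt U then ε else 0 with hd'
  have hd'_mem : d' ∈ Set.Icc 0 c ∩ {d : E → ℝ | ∀ J, bdry src tgt J = T →
      δ ≤ joinCost d J - ∑ e, d e * x e} := by
    refine ⟨⟨fun e => ?_, fun e => ?_⟩, fun J hJ => ?_⟩
    · simp only [hd', Pi.zero_apply]
      split_ifs with h
      · linarith [hεd e h]
      · simpa using hd0 e
    · have := hdc e
      simp only [hd']
      split_ifs <;> linarith
    · convert hεJ J hJ using 2
      · simp only [joinCost_eq_sum_filter, hd', Finset.sum_sub_distrib, sub_right_inj]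
        rw [← Finset.sum_filter, Finset.sum_const, nsmul_eq_mul, mul_comm, Finset.filter_filter]
        congr 3
        ext e
        simp [and_comm]
      · simp [hd', sub_mul, Finset.sum_sub_distrib, Finset.mul_sum]
  have hle : ∑ e, d e ≤ ∑ e, d' e := hdmin hd'_mem
  have hne : (cutset src tgt U).Nonempty := by
    rw [Finset.nonempty_iff_ne_empty]
    intro h
    rw [h] at hxU
    norm_num at hxU
  have : (0 : ℝ) < #(cutset src tgt U) := by exact_mod_cast hne.card_pos
  simp only [hd', Finset.sum_sub_distrib, Finset.sum_ite_mem, Finset.univ_inter, Finset.sum_const,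
    nsmul_eq_mul] at hle
  nlinarith

end Joins

section TwoEdgeConnected

variable {V E : Type} [Fintype V] [Fintype E] [DecidableEq V] {src tgt : E → V}

lemma sum_bdry_one (src tgt : E → V) (U : Finset V) :
    ∑ v ∈ U, bdry src tgt (1 : E → ZMod 2) v = #(cutset src tgt U) := by
  simp [sum_bdry_eq_sum_cutset]

lemma EdgeConnected.three_le_card_cutset (h : EdgeConnected src tgt 2) {U : Finset V}
    (hU : Odd #(cutset src tgt U)) : 3 ≤ #(cutset src tgt U) := by
  have h2 : 2 ≤ #(cutset src tgt U) := by
    refine h U ?_ ?_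
    · rw [Finset.nonempty_iff_ne_empty]
      rintro rfl
      simp [cutset] at hU
    · rintro rfl
      simp [cutset] at hU
  obtain ⟨k, hk⟩ := hU
  lia

/-- A join with the same degree parities as the graph meets every odd cut. -/
lemma one_le_card_join_inter_cutset {J : E → ZMod 2} (hJ : bdry src tgt J = bdry src tgt 1)
    {U : Finset V} (hU : Odd #(cutset src tgt U)) : 1 ≤ #{e ∈ cutset src tgt U | J e ≠ 0} := by
  rw [Nat.one_le_iff_ne_zero, Finset.card_ne_zero, Finset.nonempty_iff_ne_empty]
  intro h
  have h1 := sum_bdry_eq_sum_cutset src tgt J U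
  rw [hJ, sum_bdry_one, (ZMod.natCast_eq_one_iff_odd).2 hU, Finset.sum_eq_zero] at h1
  · exact one_ne_zero h1
  · intro e he
    by_contra hne
    exact Finset.notMem_empty e (h ▸ Finset.mem_filter.2 ⟨he, hne⟩)

/-- A 2-edge-connected graph has a postman set of size at most a third of the edges which meets
every 3-edge cut exactly once. -/
lemma exists_postman_set_meeting_three_cuts_once [DecidableEq E] (h : EdgeConnected src tgt 2) :
    ∃ J : E → ZMod 2, bdry src tgt J = bdry src tgt 1 ∧ 3 * #{e | J e ≠ 0} ≤ Fintype.card E ∧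
      ∀ U : Finset V, #(cutset src tgt U) = 3 → #{e ∈ cutset src tgt U | J e ≠ 0} = 1 := by
  set 𝓤 : Finset (Finset V) := {U | #(cutset src tgt U) = 3} with h𝓤
  set N : ℝ := Fintype.card E + 1
  obtain ⟨J, hJ, hcost⟩ := exists_join_joinCost_le (src := src) (tgt := tgt)
    (x := fun _ => 1 / 3) (c := fun e => (∑ U ∈ 𝓤, if e ∈ cutset src tgt U then N else 0) + 1)
    (T := bdry src tgt 1) (fun _ => by norm_num)
    (fun e => add_nonneg (Finset.sum_nonneg fun U _ => by split_ifs <;> positivity) zero_le_one)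
    ⟨1, rfl⟩ (fun U hU => by
      rw [sum_bdry_one, ZMod.natCast_eq_one_iff_odd] at hU
      have : (3 : ℝ) ≤ #(cutset src tgt U) := by exact_mod_cast h.three_le_card_cutset hU
      rw [Finset.sum_const, nsmul_eq_mul]
      linarith)
  have hmeet : ∀ U ∈ 𝓤, 1 ≤ #{e ∈ cutset src tgt U | J e ≠ 0} := fun U hU =>
    one_le_card_join_inter_cutset hJ (by
      rw [(Finset.mem_filter.1 hU).2]; decide)
  have hleft : joinCost (fun e => (∑ U ∈ 𝓤, if e ∈ cutset src tgt U then N else 0) + 1) J =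
      N * (∑ U ∈ 𝓤, #{e ∈ cutset src tgt U | J e ≠ 0} : ℕ) + #{e | J e ≠ 0} := by
    rw [joinCost_eq_sum_filter, Finset.sum_add_distrib, Finset.sum_comm, Nat.cast_sum,
      Finset.mul_sum]
    congr 1
    · refine Finset.sum_congr rfl fun U _ => ?_
      rw [← Finset.sum_filter, Finset.sum_const, nsmul_eq_mul, mul_comm, Finset.filter_filter]
      congr 3
      ext e
      simp [and_comm]
    · simp
  have hright : ∑ e, ((∑ U ∈ 𝓤, if e ∈ cutset src tgt U then N else 0) + 1) * (1 / 3 : ℝ) =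
      N * #𝓤 + Fintype.card E / 3 := by
    rw [← Finset.sum_mul, Finset.sum_add_distrib, Finset.sum_comm]
    have : ∀ U ∈ 𝓤, (∑ e, if e ∈ cutset src tgt U then N else 0) = 3 * N := by
      intro U hU
      simp [(Finset.mem_filter.1 hU).2]
    rw [Finset.sum_congr rfl this]
    simp
    ring
  rw [hleft, hright] at hcost
  have hge : #𝓤 ≤ ∑ U ∈ 𝓤, #{e ∈ cutset src tgt U | J e ≠ 0} := by
    simpa using Finset.sum_le_sum hmeet
  have hEnn : (0 : ℝ) ≤ Fintype.card E := Nat.cast_nonneg _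
  have hJnn : (0 : ℝ) ≤ #{e | J e ≠ 0} := Nat.cast_nonneg _
  have hle : ∑ U ∈ 𝓤, #{e ∈ cutset src tgt U | J e ≠ 0} ≤ #𝓤 := by
    by_contra! hlt
    have : (#𝓤 : ℝ) + 1 ≤ (∑ U ∈ 𝓤, #{e ∈ cutset src tgt U | J e ≠ 0} : ℕ) := by
      exact_mod_cast hlt
    nlinarith
  have heq := le_antisymm hge hle
  refine ⟨J, hJ, ?_, fun U hU => ?_⟩
  · rw [← heq] at hcost
    have : (3 * #{e | J e ≠ 0} : ℝ) ≤ Fintype.card E := by linarith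
    exact_mod_cast this
  · have hone := (Finset.sum_eq_sum_iff_of_le hmeet).1 (by simpa using heq)
    exact (hone U (by simp [h𝓤, hU])).symm

/-- A 2-edge-connected graph has two postman sets sharing at most `1/15` of the edges. -/
lemma exists_postman_sets_small_inter [DecidableEq E] (h : EdgeConnected src tgt 2) :
    ∃ J K : E → ZMod 2, bdry src tgt J = bdry src tgt 1 ∧ bdry src tgt K = bdry src tgt 1 ∧
      15 * #{e | J e ≠ 0 ∧ K e ≠ 0} ≤ Fintype.card E := by
  obtain ⟨J, hJ, hcard, hthree⟩ := exists_postman_set_meeting_three_cuts_once h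
  obtain ⟨K, hK, hcost⟩ := exists_join_joinCost_le (src := src) (tgt := tgt)
    (x := fun e => 2 / 5 - if J e ≠ 0 then 1 / 5 else 0) (c := fun e => if J e ≠ 0 then 1 else 0)
    (T := bdry src tgt 1) (fun e => by split_ifs <;> norm_num)
    (fun e => by split_ifs <;> norm_num) ⟨1, rfl⟩ (fun U hU => by
      rw [sum_bdry_one, ZMod.natCast_eq_one_iff_odd] at hU
      rw [Finset.sum_sub_distrib, ← Finset.sum_filter, Finset.sum_const, Finset.sum_const,
        nsmul_eq_mul, nsmul_eq_mul]
      have h3 := h.three_le_card_cutset hU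
      by_cases h3' : #(cutset src tgt U) = 3
      · rw [hthree U h3', h3']
        norm_num
      · have h5 : 5 ≤ #(cutset src tgt U) := by
          obtain ⟨k, hk⟩ := hU
          lia
        have h5' : (5 : ℝ) ≤ #(cutset src tgt U) := by exact_mod_cast h5
        have hle : (#{e ∈ cutset src tgt U | J e ≠ 0} : ℝ) ≤ #(cutset src tgt U) := by
          exact_mod_cast Finset.card_filter_le _ _
        linarith)
  refine ⟨J, K, hJ, hK, ?_⟩
  have hleft : joinCost (fun e => if J e ≠ 0 then 1 else 0) K = #{e | J e ≠ 0 ∧ K e ≠ 0} := by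
    rw [joinCost_eq_sum_filter, ← Finset.sum_filter, Finset.filter_filter, Finset.sum_const,
      nsmul_eq_mul, mul_one]
    simp only [and_comm]
  have hright : ∑ e, (if J e ≠ 0 then 1 else 0) * (2 / 5 - if J e ≠ 0 then 1 / 5 else 0 : ℝ) =
      #{e | J e ≠ 0} * (1 / 5) := by
    rw [← nsmul_eq_mul, ← Finset.sum_const, Finset.sum_filter]
    refine Finset.sum_congr rfl fun e _ => ?_
    split_ifs <;> norm_num
  rw [hleft, hright] at hcost
  have : (15 * #{e | J e ≠ 0 ∧ K e ≠ 0} : ℝ) ≤ 3 * #{e | J e ≠ 0} := by linarith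
  exact le_trans (by exact_mod_cast this) hcard

end TwoEdgeConnected

/-- Every 2-edge-connected finite graph (loops and multiple edges allowed) has an integer
4-flow `φ` with `|supp(φ)| ≥ (14/15)|E(G)|`. -/
theorem four_flow_support_two_edge_connected
    (V E : Type) [Fintype V] [Fintype E] [DecidableEq V] [DecidableEq E]
    (src tgt : E → V)
    (h2ec : EdgeConnected src tgt 2) :
    ∃ φ : E → ℤ,
      (∀ v : V, bdry src tgt φ v = 0) ∧
      (∀ e : E, |φ e| ≤ 3) ∧
      14 * Fintype.card E ≤ 15 * (Finset.univ.filter fun e => φ e ≠ 0).card := by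
  obtain ⟨J, K, hJ, hK, hcard⟩ := exists_postman_sets_small_inter h2ec
  have even_compl : ∀ L : E → ZMod 2, bdry src tgt L = bdry src tgt 1 →
      bdry src tgt (L + 1) = 0 := fun L hL => by rw [bdry_add, hL, pi_add_self]
  obtain ⟨f, hf, hfJ⟩ := exists_unit_flow_of_even tgt src _ (even_compl J hJ)
  obtain ⟨g, hg, hgK⟩ := exists_unit_flow_of_even tgt src _ (even_compl K hK)
  have unit_or_zero : ∀ (L : E → ZMod 2) (k : E → ℤ) (e : E),
      ((L + 1) e = 0 → k e = 0) ∧ ((L + 1) e ≠ 0 → |k e| = 1) →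
        (L e ≠ 0 ∧ k e = 0) ∨ k e = 1 ∨ k e = -1 := by
    intro L k e hk
    by_cases hL : (L + 1) e = 0
    · exact Or.inl ⟨fun h0 => by simp [h0] at hL, hk.1 hL⟩
    · exact Or.inr (eq_or_eq_neg_of_abs_eq (hk.2 hL))
  refine ⟨(2 : ℤ) • f + g, fun v => ?_, fun e => ?_, ?_⟩
  · rw [bdry_add, bdry_zsmul, hf, hg]
    simp
  · rw [abs_le]
    have h1 := unit_or_zero J f e (hfJ e)
    have h2 := unit_or_zero K g e (hgK e)
    simp only [Pi.add_apply, Pi.smul_apply, smul_eq_mul]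
    lia
  · have hsub : (univ.filter fun e => ¬ ((2 : ℤ) • f + g) e ≠ 0) ⊆
        univ.filter fun e => J e ≠ 0 ∧ K e ≠ 0 := by
      intro e he
      have h1 := unit_or_zero J f e (hfJ e)
      have h2 := unit_or_zero K g e (hgK e)
      simp only [mem_filter, mem_univ, true_and, Pi.add_apply, Pi.smul_apply, smul_eq_mul,
        not_not] at he ⊢
      constructor
      · rcases h1 with h1 | h1
        · exact h1.1
        · lia
      · rcases h2 with h2 | h2
        · exact h2.1
        · lia
    have h1 := Finset.card_le_card hsub
    have h2 := Finset.card_filter_add_card_filter_not (s := (univ : Finset E))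
      (fun e => ((2 : ℤ) • f + g) e ≠ 0)
    rw [Finset.card_univ] at h2
    lia
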